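/- There exist two distinct Ulam sequences U and U′ starting with 2, X in G₁; specifically, one can find such U, U′ with U ∩ [2, 2X+1] = {2} ∪ {X + 2k : k ∈ ℕ} ∪ {2X − 2k : k ∈ ℕ} and U′ ∩ [2, 2X+1] = {2} ∪ {X + 2k : k ∈ ℕ} ∪ {2X − 2k + 1 : k ∈ ℕ}. In particular, Ulam sequences in G₁ with given starting elements need not be unique. -/

import Mathlib

/-- Candidates for the next Ulam element beyond `w`: elements `q` that are greater than every
element of `U ∩ (−∞, w)` and can be written as `x + y` with `x ≠ y` both in `U` in exactly
one way. -/
def ulamNext (U : Set (ℤ ×ₗ ℤ)) (w : ℤ ×ₗ ℤ) : Set (ℤ ×ₗ ℤ) :=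
  {q | (∀ x ∈ U, x < w → x < q) ∧
    ∃! p : (ℤ ×ₗ ℤ) × (ℤ ×ₗ ℤ), p.1 < p.2 ∧ p.1 ∈ U ∧ p.2 ∈ U ∧ q = p.1 + p.2}

/-- `U` is an Ulam sequence starting with `u, v` in the lexicographically ordered group
`G₁ = ℤ ×ₗ ℤ` (the pair `(a,b)` representing `aX + b`): (1) `U ∩ (−∞, v] = {u, v}`;
(2) every nonempty `U ∩ [p,q]` has a minimum and a maximum; (3) for `w > v`, `w ∈ U` iff
`w` is the smallest element of `ulamNext U w`. -/
def IsUlamSeq (u v : ℤ ×ₗ ℤ) (U : Set (ℤ ×ₗ ℤ)) : Prop :=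
  U ∩ Set.Iic v = {u, v} ∧
  (∀ p q : ℤ ×ₗ ℤ, p < q → (U ∩ Set.Icc p q).Nonempty →
    (∃ m ∈ U ∩ Set.Icc p q, ∀ x ∈ U ∩ Set.Icc p q, m ≤ x) ∧
    (∃ M ∈ U ∩ Set.Icc p q, ∀ x ∈ U ∩ Set.Icc p q, x ≤ M)) ∧
  (∀ w, v < w → (w ∈ U ↔ w ∈ ulamNext U w ∧ ∀ q ∈ ulamNext U w, w ≤ q))

namespace UlamLevels

/-- A representation of the element `b` of level `n` as a sum of two distinct elements `x`, `y`
of positive levels `i`, `j`, where `M k` is the set of elements of level `k`. -/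
def Rep (M : ℕ → ℤ → Prop) (n : ℕ) (b : ℤ) (i : ℕ) (x : ℤ) (j : ℕ) (y : ℤ) : Prop :=
  1 ≤ i ∧ 1 ≤ j ∧ i + j = n ∧ x + y = b ∧ M i x ∧ M j y ∧ ¬(i = j ∧ x = y)

/-- There is no representation of `b` at level `n` by elements of positive levels. -/
def NoRep (M : ℕ → ℤ → Prop) (n : ℕ) (b : ℤ) : Prop :=
  ∀ i x j y, ¬ Rep M n b i x j y

/-- There is exactly one unordered representation of `b` at level `n` by elements of positive
levels. -/
def OneRep (M : ℕ → ℤ → Prop) (n : ℕ) (b : ℤ) : Prop :=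
  ∃ i x j y, Rep M n b i x j y ∧
    ∀ i' x' j' y', Rep M n b i' x' j' y' → (i' = i ∧ x' = x) ∨ (i' = j ∧ x' = y)

/-- The Ulam rule: an element belongs to the sequence if it has exactly one representation;
`q` says whether the representation by the first element `2` is available, and `Z`, `O` whether
there are no, or exactly one, other representations. -/
def Step (Z O q : Prop) : Prop := (q ∧ Z) ∨ (¬ q ∧ O)

/-- Some two tails produce infinitely many representations. -/
def ManyReps (Qp Qm : ℕ → ℤ → Prop) (n : ℕ) (b : ℤ) : Prop :=
  ∃ i j x y, 1 ≤ i ∧ 1 ≤ j ∧ i + j = n ∧ x + y = b ∧ Qp i x ∧ (Qp j y ∨ Qm j y)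

/-- A representation of `b` by an element `x` and an element of an upper tail. -/
def TailRep (M Qp : ℕ → ℤ → Prop) (n : ℕ) (b : ℤ) (i : ℕ) (x : ℤ) : Prop :=
  ∃ j y, 1 ≤ i ∧ 1 ≤ j ∧ i + j = n ∧ x + y = b ∧ M i x ∧ Qp j y

/-- The value of `NoRep` near `+∞`. -/
def TailNo (M Qp Qm : ℕ → ℤ → Prop) (n : ℕ) (b : ℤ) : Prop :=
  ¬ ManyReps Qp Qm n b ∧ ∀ i x, ¬ TailRep M Qp n b i x

/-- The value of `OneRep` near `+∞`. -/
def TailOne (M Qp Qm : ℕ → ℤ → Prop) (n : ℕ) (b : ℤ) : Prop :=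
  ¬ ManyReps Qp Qm n b ∧ ∃ i x, TailRep M Qp n b i x ∧
    ∀ i' x', TailRep M Qp n b i' x' → i' = i ∧ x' = x

theorem Rep.symm {M : ℕ → ℤ → Prop} {n : ℕ} {b : ℤ} {i : ℕ} {x : ℤ} {j : ℕ} {y : ℤ}
    (h : Rep M n b i x j y) : Rep M n b j y i x := by
  obtain ⟨h1, h2, h3, h4, h5, h6, h7⟩ := h
  exact ⟨h2, h1, by omega, by omega, h6, h5, fun h => h7 ⟨h.1.symm, h.2.symm⟩⟩

theorem Rep.congr {M M' : ℕ → ℤ → Prop} {n : ℕ} (hM : ∀ i < n, M i = M' i) (b : ℤ) (i : ℕ) (x : ℤ)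
    (j : ℕ) (y : ℤ) : Rep M n b i x j y ↔ Rep M' n b i x j y := by
  unfold Rep
  constructor <;> rintro ⟨h1, h2, h3, h4, h5, h6, h7⟩
  · exact ⟨h1, h2, h3, h4, hM i (by omega) ▸ h5, hM j (by omega) ▸ h6, h7⟩
  · exact ⟨h1, h2, h3, h4, (hM i (by omega)).symm ▸ h5, (hM j (by omega)).symm ▸ h6, h7⟩

theorem NoRep.congr {M M' : ℕ → ℤ → Prop} {n : ℕ} (hM : ∀ i < n, M i = M' i) (b : ℤ) :
    NoRep M n b ↔ NoRep M' n b := by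
  simp only [NoRep, Rep.congr hM]

theorem OneRep.congr {M M' : ℕ → ℤ → Prop} {n : ℕ} (hM : ∀ i < n, M i = M' i) (b : ℤ) :
    OneRep M n b ↔ OneRep M' n b := by
  simp only [OneRep, Rep.congr hM]

theorem not_noRep_and_not_oneRep {M : ℕ → ℤ → Prop} {n : ℕ} {b : ℤ} {i j : ℕ} {x y x' y' : ℤ}
    (h : Rep M n b i x j y) (h' : Rep M n b i x' j y') (hx : x ≠ x') (hy : x ≠ y') :
    ¬ NoRep M n b ∧ ¬ OneRep M n b := by
  refine ⟨fun hn => hn _ _ _ _ h, ?_⟩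
  rintro ⟨i₀, x₀, j₀, y₀, h₀, hu⟩
  have h1 := hu _ _ _ _ h
  have h2 := hu _ _ _ _ h'
  obtain ⟨-, -, -, e1, -⟩ := h'
  obtain ⟨-, -, -, e2, -⟩ := h₀
  omega

section Tails

variable {M Qp Qm : ℕ → ℤ → Prop} {n : ℕ} {d N : ℤ}

theorem many_of_manyReps (hd : 0 < d) (hN : 0 ≤ N)
    (hQp : ∀ i, i < n → Function.Periodic (Qp i) d)
    (hQm : ∀ i, i < n → Function.Periodic (Qm i) d)
    (hp : ∀ i, 1 ≤ i → i < n → ∀ x, N ≤ x → (M i x ↔ Qp i x))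
    (hm : ∀ i, 1 ≤ i → i < n → ∀ x, x ≤ -N → (M i x ↔ Qm i x))
    {b : ℤ} (hb : 2 * N + 4 * d ≤ b) (h : ManyReps Qp Qm n b) :
    ¬ NoRep M n b ∧ ¬ OneRep M n b := by
  obtain ⟨i, j, x, y, hi, hj, hij, hxy, hx, hy⟩ := h
  have hin : i < n := by omega
  have hjn : j < n := by omega
  have shift : ∀ {Q : ℤ → Prop}, Function.Periodic Q d → ∀ (k z z' : ℤ), z' = z + k * d →
      Q z → Q z' := by
    intro Q hQ k z z' hz h
    rw [hz]
    exact (hQ.int_mul k z).symm ▸ h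
  rcases hy with hy | hy
  · have e1 := Int.emod_add_mul_ediv (x - N) d
    have e2 := Int.emod_nonneg (x - N) hd.ne'
    have e3 := Int.emod_lt_of_pos (x - N) hd
    set r := (x - N) % d
    set k := (x - N) / d
    refine not_noRep_and_not_oneRep (i := i) (j := j) (x := N + r) (y := b - (N + r))
      (x' := N + r + d) (y' := b - (N + r + d)) ?_ ?_ (by omega) (by omega)
    · refine ⟨hi, hj, hij, by omega, ?_, ?_, by omega⟩
      · exact (hp i hi hin _ (by omega)).2 (shift (hQp i hin) (-k) x _ (by linarith) hx)
      · exact (hp j hj hjn _ (by omega)).2 (shift (hQp j hjn) k y _ (by linarith) hy)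
    · refine ⟨hi, hj, hij, by omega, ?_, ?_, by omega⟩
      · exact (hp i hi hin _ (by omega)).2 (shift (hQp i hin) (-k + 1) x _ (by linarith) hx)
      · exact (hp j hj hjn _ (by omega)).2 (shift (hQp j hjn) (k - 1) y _ (by linarith) hy)
  · have e1 := Int.emod_add_mul_ediv (x - (b + N)) d
    have e2 := Int.emod_nonneg (x - (b + N)) hd.ne'
    have e3 := Int.emod_lt_of_pos (x - (b + N)) hd
    set r := (x - (b + N)) % d
    set k := (x - (b + N)) / d
    refine not_noRep_and_not_oneRep (i := i) (j := j) (x := b + N + r) (y := b - (b + N + r))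
      (x' := b + N + r + d) (y' := b - (b + N + r + d)) ?_ ?_ (by omega) (by omega)
    · refine ⟨hi, hj, hij, by omega, ?_, ?_, by omega⟩
      · exact (hp i hi hin _ (by omega)).2 (shift (hQp i hin) (-k) x _ (by linarith) hx)
      · exact (hm j hj hjn _ (by omega)).2 (shift (hQm j hjn) k y _ (by linarith) hy)
    · refine ⟨hi, hj, hij, by omega, ?_, ?_, by omega⟩
      · exact (hp i hi hin _ (by omega)).2 (shift (hQp i hin) (-k + 1) x _ (by linarith) hx)
      · exact (hm j hj hjn _ (by omega)).2 (shift (hQm j hjn) (k - 1) y _ (by linarith) hy)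

/-- Near `+∞` the number of representations (none, one, or more) is determined by the tails and
the bounded parts of the lower levels. -/
theorem noRep_and_oneRep_iff_tail (hd : 0 < d) (hN : 0 ≤ N)
    (hQp : ∀ i, i < n → Function.Periodic (Qp i) d)
    (hQm : ∀ i, i < n → Function.Periodic (Qm i) d)
    (hp : ∀ i, 1 ≤ i → i < n → ∀ x, N ≤ x → (M i x ↔ Qp i x))
    (hm : ∀ i, 1 ≤ i → i < n → ∀ x, x ≤ -N → (M i x ↔ Qm i x))
    {b : ℤ} (hb : 2 * N + 4 * d ≤ b) :
    (NoRep M n b ↔ TailNo M Qp Qm n b) ∧ (OneRep M n b ↔ TailOne M Qp Qm n b) := by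
  by_cases hmany : ManyReps Qp Qm n b
  · have := many_of_manyReps hd hN hQp hQm hp hm hb hmany
    exact ⟨⟨fun h => (this.1 h).elim, fun h => (h.1 hmany).elim⟩,
      ⟨fun h => (this.2 h).elim, fun h => (h.1 hmany).elim⟩⟩
  have tail_of_rep : ∀ {i x j y}, Rep M n b i x j y → N ≤ y → TailRep M Qp n b i x := by
    rintro i x j y ⟨h1, h2, h3, h4, h5, h6, -⟩ hy
    exact ⟨j, y, h1, h2, h3, h4, h5, (hp j h2 (by omega) y hy).1 h6⟩
  have rep_of_tail : ∀ {i x}, TailRep M Qp n b i x → x < N ∧ ∃ j y, N ≤ y ∧ Rep M n b i x j y := by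
    rintro i x ⟨j, y, h1, h2, h3, h4, h5, h6⟩
    have hx : x < N := by
      by_contra! hx
      exact hmany ⟨i, j, x, y, h1, h2, h3, h4, (hp i h1 (by omega) x hx).1 h5, Or.inl h6⟩
    have hx' : -N < x := by
      by_contra! hx
      exact hmany ⟨j, i, y, x, h2, h1, by omega, by omega, h6,
        Or.inr ((hm i h1 (by omega) x hx).1 h5)⟩
    exact ⟨hx, j, y, by omega, h1, h2, h3, h4, h5, (hp j h2 (by omega) y (by omega)).2 h6,
      by omega⟩
  have far : ∀ {i x j y}, Rep M n b i x j y → N ≤ x ∨ N ≤ y := by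
    rintro i x j y ⟨-, -, -, h, -⟩
    omega
  constructor
  · constructor
    · intro h
      refine ⟨hmany, fun i x ht => ?_⟩
      obtain ⟨-, j, y, -, hr⟩ := rep_of_tail ht
      exact h _ _ _ _ hr
    · rintro ⟨-, h⟩ i x j y hr
      rcases far hr with hx | hy
      · exact h _ _ (tail_of_rep hr.symm hx)
      · exact h _ _ (tail_of_rep hr hy)
  · constructor
    · rintro ⟨i, x, j, y, hr, hu⟩
      refine ⟨hmany, ?_⟩
      have key : ∀ {i x j y}, Rep M n b i x j y → N ≤ y → (∀ i' x' j' y',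
          Rep M n b i' x' j' y' → (i' = i ∧ x' = x) ∨ (i' = j ∧ x' = y)) →
          ∃ i x, TailRep M Qp n b i x ∧ ∀ i' x', TailRep M Qp n b i' x' → i' = i ∧ x' = x := by
        intro i x j y hr hy hu
        refine ⟨i, x, tail_of_rep hr hy, fun i' x' ht => ?_⟩
        obtain ⟨hx', j', y', -, hr'⟩ := rep_of_tail ht
        rcases hu _ _ _ _ hr' with h | h
        · exact h
        · omega
      rcases far hr with hx | hy
      · exact key hr.symm hx fun i' x' j' y' h => (hu i' x' j' y' h).symm
      · exact key hr hy hu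
    · rintro ⟨-, i, x, ht, hu⟩
      obtain ⟨-, j, y, -, hr⟩ := rep_of_tail ht
      refine ⟨i, x, j, y, hr, fun i' x' j' y' hr' => ?_⟩
      rcases far hr' with hx | hy
      · have := hu _ _ (tail_of_rep hr'.symm hx)
        obtain ⟨-, -, h3, h4, -⟩ := hr
        obtain ⟨-, -, h3', h4', -⟩ := hr'
        omega
      · exact Or.inl (hu _ _ (tail_of_rep hr' hy))

theorem periodic_manyReps (hQp : ∀ i, i < n → Function.Periodic (Qp i) d)
    (hQm : ∀ i, i < n → Function.Periodic (Qm i) d) :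
    Function.Periodic (ManyReps Qp Qm n) d := by
  intro b
  apply propext
  constructor
  · rintro ⟨i, j, x, y, hi, hj, hij, hxy, hx, hy⟩
    refine ⟨i, j, x, y - d, hi, hj, hij, by omega, hx, ?_⟩
    rwa [(hQp j (by omega)).sub_eq, (hQm j (by omega)).sub_eq]
  · rintro ⟨i, j, x, y, hi, hj, hij, hxy, hx, hy⟩
    refine ⟨i, j, x, y + d, hi, hj, hij, by omega, hx, ?_⟩
    rwa [hQp j (by omega), hQm j (by omega)]

theorem periodic_tailRep (hQp : ∀ i, i < n → Function.Periodic (Qp i) d) :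
    Function.Periodic (TailRep M Qp n) d := by
  intro b
  funext i x
  apply propext
  constructor
  · rintro ⟨j, y, hi, hj, hij, hxy, hx, hy⟩
    refine ⟨j, y - d, hi, hj, hij, by omega, hx, ?_⟩
    rwa [(hQp j (by omega)).sub_eq]
  · rintro ⟨j, y, hi, hj, hij, hxy, hx, hy⟩
    refine ⟨j, y + d, hi, hj, hij, by omega, hx, ?_⟩
    rwa [hQp j (by omega)]

theorem periodic_tailNo (hQp : ∀ i, i < n → Function.Periodic (Qp i) d)
    (hQm : ∀ i, i < n → Function.Periodic (Qm i) d) :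
    Function.Periodic (TailNo M Qp Qm n) d := by
  intro b
  simp only [TailNo, periodic_manyReps hQp hQm b, periodic_tailRep hQp b]

theorem periodic_tailOne (hQp : ∀ i, i < n → Function.Periodic (Qp i) d)
    (hQm : ∀ i, i < n → Function.Periodic (Qm i) d) :
    Function.Periodic (TailOne M Qp Qm n) d := by
  intro b
  simp only [TailOne, periodic_manyReps hQp hQm b, periodic_tailRep hQp b]

end Tails

section Reflection

variable {M P : ℕ → ℤ → Prop} {n : ℕ} {d N : ℤ}

theorem rep_neg {b : ℤ} {i : ℕ} {x : ℤ} {j : ℕ} {y : ℤ} :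
    Rep (fun i x => M i (-x)) n (-b) i (-x) j (-y) ↔ Rep M n b i x j y := by
  simp only [Rep, neg_neg, neg_inj]
  rw [show -x + -y = -b ↔ x + y = b by omega]

theorem noRep_neg {b : ℤ} : NoRep (fun i x => M i (-x)) n (-b) ↔ NoRep M n b := by
  constructor
  · exact fun h i x j y hr => h i (-x) j (-y) (rep_neg.2 hr)
  · intro h i x j y hr
    rw [← neg_neg x, ← neg_neg y, rep_neg] at hr
    exact h _ _ _ _ hr

theorem OneRep.neg {b : ℤ} (h : OneRep M n b) : OneRep (fun i x => M i (-x)) n (-b) := by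
  obtain ⟨i, x, j, y, hr, hu⟩ := h
  refine ⟨i, -x, j, -y, rep_neg.2 hr, fun i' x' j' y' hr' => ?_⟩
  rw [← neg_neg x', ← neg_neg y', rep_neg] at hr'
  have := hu _ _ _ _ hr'
  omega

theorem oneRep_neg {b : ℤ} : OneRep (fun i x => M i (-x)) n (-b) ↔ OneRep M n b := by
  refine ⟨fun h => ?_, OneRep.neg⟩
  have := h.neg
  simpa only [neg_neg] using this

theorem manyReps_neg (hP : ∀ x, ¬ P 0 x) {b : ℤ} :
    ManyReps (fun i x => P (i - 1) (-x)) (fun i x => P i (-x)) (n + 1) (-b) ↔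
      ManyReps P (fun i => P (i - 1)) n b := by
  have pos : ∀ {i x}, P i x → 1 ≤ i := by
    intro i x h
    rcases Nat.eq_zero_or_pos i with rfl | hi
    · exact (hP _ h).elim
    · exact hi
  constructor
  · rintro ⟨i, j, x, y, hi, hj, hij, hxy, hx, hy | hy⟩
    · have := pos hx
      exact ⟨i - 1, j, -x, -y, this, hj, by omega, by omega, hx, Or.inr hy⟩
    · have := pos hx
      exact ⟨i - 1, j, -x, -y, this, hj, by omega, by omega, hx, Or.inl hy⟩
  · rintro ⟨i, j, x, y, hi, hj, hij, hxy, hx, hy | hy⟩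
    · exact ⟨i + 1, j, -x, -y, by omega, hj, by omega, by omega,
        by simpa using hx, Or.inr (by simpa using hy)⟩
    · exact ⟨i + 1, j, -x, -y, by omega, hj, by omega, by omega,
        by simpa using hx, Or.inl (by simpa using hy)⟩

theorem tailRep_neg (hP : ∀ x, ¬ P 0 x) {b : ℤ} {i : ℕ} {x : ℤ} :
    TailRep (fun i x => M i (-x)) (fun i x => P (i - 1) (-x)) (n + 1) (-b) i (-x) ↔
      TailRep M P n b i x := by
  constructor
  · rintro ⟨j, y, hi, hj, hij, hxy, hx, hy⟩
    have : j - 1 ≠ 0 := fun h => hP (-y) (h ▸ hy)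
    exact ⟨j - 1, -y, hi, by omega, by omega, by omega, by simpa using hx, hy⟩
  · rintro ⟨j, y, hi, hj, hij, hxy, hx, hy⟩
    exact ⟨j + 1, -y, hi, by omega, by omega, by omega, by simpa using hx, by simpa using hy⟩

theorem tailNo_neg (hP : ∀ x, ¬ P 0 x) {b : ℤ} :
    TailNo (fun i x => M i (-x)) (fun i x => P (i - 1) (-x)) (fun i x => P i (-x)) (n + 1) (-b) ↔
      TailNo M P (fun i => P (i - 1)) n b := by
  unfold TailNo
  rw [manyReps_neg hP]
  refine and_congr_right fun _ => forall_congr' fun i => ⟨fun h x ht => ?_, fun h x ht => ?_⟩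
  · exact h (-x) ((tailRep_neg hP).2 ht)
  · rw [← neg_neg x, tailRep_neg hP] at ht
    exact h _ ht

theorem tailOne_neg (hP : ∀ x, ¬ P 0 x) {b : ℤ} :
    TailOne (fun i x => M i (-x)) (fun i x => P (i - 1) (-x)) (fun i x => P i (-x)) (n + 1) (-b) ↔
      TailOne M P (fun i => P (i - 1)) n b := by
  unfold TailOne
  rw [manyReps_neg hP]
  refine and_congr_right fun _ => ⟨?_, ?_⟩
  · rintro ⟨i, x, ht, hu⟩
    rw [← neg_neg x, tailRep_neg hP] at ht
    refine ⟨i, -x, ht, fun i' x' ht' => ?_⟩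
    have := hu i' (-x') ((tailRep_neg hP).2 ht')
    omega
  · rintro ⟨i, x, ht, hu⟩
    refine ⟨i, -x, (tailRep_neg hP).2 ht, fun i' x' ht' => ?_⟩
    rw [← neg_neg x', tailRep_neg hP] at ht'
    have := hu i' (-x') ht'
    omega

/-- When the lower tail of each level continues the upper tail of the previous level, so does the
number of representations: level `n + 1` near `-∞` looks like level `n` near `+∞`. -/
theorem noRep_and_oneRep_succ_iff_tail (hP0 : ∀ x, ¬ P 0 x) (hd : 0 < d) (hN : 0 ≤ N)
    (hP : ∀ i, i < n + 1 → Function.Periodic (P i) d)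
    (hp : ∀ i, 1 ≤ i → i < n + 1 → ∀ x, N ≤ x → (M i x ↔ P i x))
    (hm : ∀ i, 1 ≤ i → i < n + 1 → ∀ x, x ≤ -N → (M i x ↔ P (i - 1) x))
    {b : ℤ} (hb : b ≤ -(2 * N + 4 * d)) :
    (NoRep M (n + 1) b ↔ TailNo M P (fun i => P (i - 1)) n b) ∧
      (OneRep M (n + 1) b ↔ TailOne M P (fun i => P (i - 1)) n b) := by
  have neg_periodic : ∀ {Q : ℤ → Prop}, Function.Periodic Q d →
      Function.Periodic (fun x => Q (-x)) d := by
    intro Q hQ x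
    simp only [neg_add, ← sub_eq_add_neg, hQ.sub_eq]
  have := noRep_and_oneRep_iff_tail (M := fun i x => M i (-x)) (Qp := fun i x => P (i - 1) (-x))
    (Qm := fun i x => P i (-x)) (n := n + 1) (b := -b) hd hN
    (fun i hi => neg_periodic (hP (i - 1) (by omega))) (fun i hi => neg_periodic (hP i hi))
    (fun i h1 hi x hx => hm i h1 hi (-x) (by omega))
    (fun i h1 hi x hx => hp i h1 hi (-x) (by omega)) (by omega)
  rwa [noRep_neg, oneRep_neg, tailNo_neg hP0, tailOne_neg hP0] at this

end Reflection

/-- A set following `P` up to `B` and, beyond, the Ulam rule. -/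
theorem exists_step_extension (B : ℤ) (P Z O : ℤ → Prop) :
    ∃ g : ℤ → Prop, (∀ b ≤ B, (g b ↔ P b)) ∧ ∀ b, B < b → (g b ↔ Step (Z b) (O b) (g (b - 2))) := by
  let G : ℕ → (ℤ → Prop) := fun k => Nat.rec P
    (fun k g b => if b = B + k + 1 then Step (Z b) (O b) (g (b - 2)) else g b) k
  have hG : ∀ k b, G (k + 1) b =
      if b = B + k + 1 then Step (Z b) (O b) (G k (b - 2)) else G k b := fun _ _ => rfl
  have stable : ∀ (k l : ℕ) b, b ≤ B + k → G (k + l) b = G k b := by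
    intro k l b hb
    induction l with
    | zero => rfl
    | succ l ih => rw [← add_assoc, hG, if_neg (by push_cast; omega), ih]
  refine ⟨fun b => G (b - B).toNat b, fun b hb => ?_, fun b hb => ?_⟩
  · show G (b - B).toNat b ↔ P b
    rw [Int.toNat_of_nonpos (by omega)]
    exact Iff.rfl
  · obtain ⟨k, hk⟩ : ∃ k : ℕ, (b - B).toNat = k + 1 := ⟨(b - B).toNat - 1, by omega⟩
    have h2 := stable (b - 2 - B).toNat (k - (b - 2 - B).toNat) (b - 2) (by omega)
    rw [Nat.add_sub_cancel' (by omega)] at h2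
    simp only [hk, hG]
    rw [if_pos (by omega), h2]

theorem iterate_three_prop (ψ : Prop → Prop) (a : Prop) : ψ (ψ (ψ a)) = ψ a := by
  by_cases h1 : ψ True <;> by_cases h2 : ψ False <;> by_cases h : a <;> simp [h1, h2, h]

/-- A set following the Ulam rule with data of period `2 * d` eventually has period `4 * d`. -/
theorem eventually_periodic_of_step {B : ℤ} {d : ℕ} {g Z O : ℤ → Prop}
    (hZ : Function.Periodic Z (2 * d : ℤ)) (hO : Function.Periodic O (2 * d : ℤ))
    (hg : ∀ b, B < b → (g b ↔ Step (Z b) (O b) (g (b - 2)))) {b : ℤ} (hb : B < b) :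
    g (b + 2 * d + 4 * d) = g (b + 2 * d) := by
  have iter : ∀ k : ℕ, ∃ ψ : Prop → Prop, ∀ m : ℕ,
      g (b + m * (2 * d) + 2 * k) = ψ (g (b + m * (2 * d))) := by
    intro k
    induction k with
    | zero => exact ⟨id, fun m => by simp⟩
    | succ k ih =>
      obtain ⟨ψ, hψ⟩ := ih
      refine ⟨fun q => Step (Z (b + 2 * k + 2)) (O (b + 2 * k + 2)) (ψ q), fun m => ?_⟩
      have h0 : (0 : ℤ) ≤ m * (2 * d) := by positivity
      have hZ' := hZ.nat_mul m (b + 2 * k + 2)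
      have hO' := hO.nat_mul m (b + 2 * k + 2)
      show _ = Step _ _ (ψ _)
      rw [← hψ m, ← hZ', ← hO', propext (hg _ (by push_cast; omega))]
      have e1 : b + m * (2 * d) + 2 * (k + 1 : ℕ) = b + 2 * k + 2 + m * (2 * d) := by
        push_cast
        ring
      have e2 : b + 2 * k + 2 + m * (2 * d) - 2 = b + m * (2 * d) + 2 * k := by ring
      rw [e1, e2]
  obtain ⟨ψ, hψ⟩ := iter d
  have h0 := hψ 0
  have h1 := hψ 1
  have h2 := hψ 2
  have e1 : g (b + 2 * d) = ψ (g b) := by simpa using h0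
  have e2 : g (b + 2 * d + 2 * d) = ψ (g (b + 2 * d)) := by simpa using h1
  have e3 : g (b + 2 * d + 4 * d) = ψ (g (b + 2 * d + 2 * d)) := by
    have a1 : b + (2 : ℕ) * (2 * d) + 2 * d = b + 2 * d + 4 * d := by
      push_cast
      ring
    have a2 : b + (2 : ℕ) * (2 * d) = b + 2 * d + 2 * (d : ℤ) := by
      push_cast
      ring
    rwa [a1, a2] at h2
  rw [e3, e2, e1]
  exact iterate_three_prop ψ (g b)

theorem exists_periodic_of_eventually {B d : ℤ} (hd : 0 < d) {g : ℤ → Prop}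
    (hg : ∀ b, B ≤ b → g (b + d) = g b) :
    ∃ P : ℤ → Prop, Function.Periodic P d ∧ ∀ b, B ≤ b → (g b ↔ P b) := by
  refine ⟨fun b => g (B + (b - B) % d), fun b => ?_, fun b hb => ?_⟩
  · show g _ = g _
    rw [show b + d - B = b - B + d by ring, Int.add_emod_right]
  · have iter : ∀ (k : ℕ) c, B ≤ c → g (c + d * k) = g c := by
      intro k c hc
      induction k with
      | zero => simp
      | succ k ih =>
        rw [← ih, ← hg (c + d * k) (by have : 0 ≤ d * (k : ℤ) := by positivity
                                       omega)]
        congr 1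
        push_cast
        ring
    have e1 := Int.emod_add_mul_ediv (b - B) d
    have e2 := Int.emod_nonneg (b - B) hd.ne'
    have e3 : 0 ≤ (b - B) / d := Int.ediv_nonneg (by omega) hd.le
    have := iter ((b - B) / d).toNat (B + (b - B) % d) (by omega)
    rw [Int.toNat_of_nonneg e3, show B + (b - B) % d + d * ((b - B) / d) = b by linarith] at this
    rw [this]

/-- Sequences in which every prefix satisfying a condition can be prolonged. -/
theorem exists_seq_of_extension {α : Type*} [Inhabited α] (Good : (ℕ → α) → ℕ → Prop)
    (congr : ∀ F G n, (∀ i ≤ n, F i = G i) → Good F n → Good G n)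
    (step : ∀ F n, (∀ i < n, Good F i) → ∃ a, Good (Function.update F n a) n) :
    ∃ F, ∀ n, Good F n := by
  classical
  choose! next hnext using step
  let G : ℕ → ℕ → α := fun k => Nat.rec (fun _ => default)
    (fun k F => Function.update F k (next F k)) k
  have hG : ∀ k, G (k + 1) = Function.update (G k) k (next (G k) k) := fun _ => rfl
  have stable : ∀ k l i, i < k → G (k + l) i = G k i := by
    intro k l i hi
    induction l with
    | zero => rfl
    | succ l ih => rw [← add_assoc, hG, Function.update_of_ne (by omega), ih]
  have good : ∀ k, ∀ i < k, Good (G k) i := by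
    intro k
    induction k with
    | zero => exact fun i hi => absurd hi (Nat.not_lt_zero i)
    | succ k ih =>
      intro i hi
      rcases Nat.lt_succ_iff_lt_or_eq.1 hi with h | rfl
      · exact congr (G k) _ i (fun j hj => (stable k 1 j (by omega)).symm) (ih i h)
      · exact hnext (G i) i ih
  refine ⟨fun n => G (n + 1) n, fun n => congr (G (n + 1)) _ n (fun i hi => ?_)
    (good (n + 1) n n.lt_succ_self)⟩
  have := stable (i + 1) (n - i) i i.lt_succ_self
  rwa [show i + 1 + (n - i) = n + 1 by omega] at this

/-- The sets of elements of each level, and the periodic sets describing their upper tails. -/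
abbrev Levels := ℕ → (ℤ → Prop) × (ℤ → Prop)

/-- The elements of each level. -/
def Levels.mem (F : Levels) (n : ℕ) : ℤ → Prop := (F n).1

/-- The upper tail of each level. -/
def Levels.tail (F : Levels) (n : ℕ) : ℤ → Prop := (F n).2

/-- Level `n` of `F` is that of an Ulam sequence starting with `(0, 2), (1, e)`; moreover its upper
tail is periodic and its lower tail continues the upper tail of the previous level. -/
structure Levels.Good (e : ℤ) (F : Levels) (n : ℕ) : Prop where
  periodic : Function.Periodic (F.tail n) (2 ^ n)
  top : ∃ N : ℤ, ∀ x ≥ N, (F.mem n x ↔ F.tail n x)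
  bot : ∃ N : ℤ, ∀ x ≤ N, (F.mem n x ↔ F.tail (n - 1) x)
  mem_zero : n = 0 → (∀ x, F.mem 0 x ↔ x = 2) ∧ ∀ x, ¬ F.tail 0 x
  mem_one : n = 1 → (∀ x, F.mem 1 x ↔ e ≤ x ∧ 2 ∣ x - e) ∧ ∀ x, F.tail 1 x ↔ 2 ∣ x - e
  step : 1 ≤ n → ∀ x, (n = 1 → e < x) →
    (F.mem n x ↔ Step (NoRep F.mem n x) (OneRep F.mem n x) (F.mem n (x - 2)))

theorem Levels.Good.congr {e : ℤ} {F G : Levels} {n : ℕ} (h : ∀ i ≤ n, F i = G i)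
    (hF : F.Good e n) : G.Good e n := by
  have hm : ∀ i ≤ n, F.mem i = G.mem i := fun i hi => congrArg Prod.fst (h i hi)
  have ht : ∀ i ≤ n, F.tail i = G.tail i := fun i hi => congrArg Prod.snd (h i hi)
  obtain ⟨h1, h2, h3, h4, h5, h6⟩ := hF
  rw [hm n le_rfl] at h2 h3 h6
  rw [ht n le_rfl] at h1 h2
  rw [ht (n - 1) (Nat.sub_le n 1)] at h3
  rw [hm 0 n.zero_le, ht 0 n.zero_le] at h4
  refine ⟨h1, h2, h3, h4, fun hn => ?_, fun hn x hx => ?_⟩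
  · have := h5 hn
    rwa [hm 1 hn.ge, ht 1 hn.ge] at this
  · rw [h6 hn x hx, NoRep.congr (fun i hi => hm i hi.le), OneRep.congr (fun i hi => hm i hi.le)]

theorem eq_of_periodic_of_eventually {P Q : ℤ → Prop} {d N : ℤ} (hd : 0 < d)
    (hP : Function.Periodic P d) (hQ : Function.Periodic Q d) (h : ∀ x ≥ N, (P x ↔ Q x)) (x : ℤ) :
    P x ↔ Q x := by
  have h1 := h (x + (N - x).toNat * d) (by
    have : (N - x).toNat ≤ (N - x).toNat * d := le_mul_of_one_le_right (by omega) hd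
    omega)
  rwa [hP.nat_mul _ x, hQ.nat_mul _ x] at h1

theorem Levels.exists_uniform_bound {e : ℤ} {F : Levels} {n : ℕ} (h : ∀ i < n, F.Good e i) :
    ∃ N : ℤ, 0 ≤ N ∧ (∀ i < n, ∀ x, N ≤ x → (F.mem i x ↔ F.tail i x)) ∧
      ∀ i < n, ∀ x, x ≤ -N → (F.mem i x ↔ F.tail (i - 1) x) := by
  induction n with
  | zero => exact ⟨0, le_rfl, fun i hi => absurd hi i.not_lt_zero,
      fun i hi => absurd hi i.not_lt_zero⟩
  | succ n ih =>
    obtain ⟨N, hN, h1, h2⟩ := ih fun i hi => h i (hi.trans n.lt_succ_self)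
    obtain ⟨N1, hN1⟩ := (h n n.lt_succ_self).top
    obtain ⟨N2, hN2⟩ := (h n n.lt_succ_self).bot
    refine ⟨max N (max N1 (-N2)), by omega, fun i hi x hx => ?_, fun i hi x hx => ?_⟩
    · rcases Nat.lt_succ_iff_lt_or_eq.1 hi with hi | rfl
      · exact h1 i hi x (by omega)
      · exact hN1 x (by omega)
    · rcases Nat.lt_succ_iff_lt_or_eq.1 hi with hi | rfl
      · exact h2 i hi x (by omega)
      · exact hN2 x (by omega)

theorem Levels.tail_periodic_of_le {e : ℤ} {F : Levels} {i k : ℕ} (h : F.Good e i) (hik : i ≤ k) :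
    Function.Periodic (F.tail i) (2 ^ k) := by
  obtain ⟨l, rfl⟩ := Nat.exists_eq_add_of_le hik
  have := h.periodic.nat_mul (2 ^ l)
  rwa [Nat.cast_pow, Nat.cast_ofNat, ← pow_add, add_comm] at this

/-- Levels `0` to `m + 1` of an Ulam sequence can be prolonged by a level `m + 2`. -/
theorem Levels.exists_next {e : ℤ} {F : Levels} {m : ℕ} (h : ∀ i < m + 2, F.Good e i) :
    ∃ a, Levels.Good e (Function.update F (m + 2) a) (m + 2) := by
  obtain ⟨N, hN, htop, hbot⟩ := exists_uniform_bound h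
  have hd : (0 : ℤ) < 2 ^ (m + 1) := by positivity
  have hP0 : ∀ x, ¬ F.tail 0 x := ((h 0 (by omega)).mem_zero rfl).2
  have hP : ∀ i, i < m + 2 → Function.Periodic (F.tail i) (2 ^ (m + 1) : ℤ) :=
    fun i hi => tail_periodic_of_le (h i hi) (by omega)
  set Z := TailNo F.mem F.tail (fun i => F.tail (i - 1)) with hZdef
  set O := TailOne F.mem F.tail (fun i => F.tail (i - 1)) with hOdef
  have hZ : ∀ k ≤ m + 2, Function.Periodic (Z k) (2 ^ (m + 1) : ℤ) := fun k hk =>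
    periodic_tailNo (fun i hi => hP i (by omega)) fun i hi => hP (i - 1) (by omega)
  have hO : ∀ k ≤ m + 2, Function.Periodic (O k) (2 ^ (m + 1) : ℤ) := fun k hk =>
    periodic_tailOne (fun i hi => hP i (by omega)) fun i hi => hP (i - 1) (by omega)
  set B : ℤ := 2 * N + 4 * 2 ^ (m + 1) with hB
  have counts_top : ∀ k ≤ m + 2, ∀ b, B ≤ b →
      (NoRep F.mem k b ↔ Z k b) ∧ (OneRep F.mem k b ↔ O k b) := fun k hk b hb =>
    noRep_and_oneRep_iff_tail hd hN (fun i hi => hP i (by omega))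
      (fun i hi => hP (i - 1) (by omega)) (fun i _ hi => htop i (by omega))
      (fun i _ hi => hbot i (by omega)) hb
  have counts_bot : ∀ b, b ≤ -B →
      (NoRep F.mem (m + 2) b ↔ Z (m + 1) b) ∧ (OneRep F.mem (m + 2) b ↔ O (m + 1) b) :=
    fun b hb => noRep_and_oneRep_succ_iff_tail hP0 hd hN hP (fun i _ hi => htop i hi)
      (fun i _ hi => hbot i hi) hb
  have tail_step : ∀ b, F.tail (m + 1) b ↔
      Step (Z (m + 1) b) (O (m + 1) b) (F.tail (m + 1) (b - 2)) := by
    refine eq_of_periodic_of_eventually (N := max (B + 2) (e + 1)) hd (hP (m + 1) (by omega)) ?_ ?_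
    · intro b
      have h1 := hP (m + 1) (by omega) (b - 2)
      rw [show b - 2 + 2 ^ (m + 1) = b + 2 ^ (m + 1) - 2 by ring] at h1
      simp only [hZ (m + 1) (by omega) b, hO (m + 1) (by omega) b, h1]
    · intro b hb
      have hb' := counts_top (m + 1) (by omega) b (by omega)
      rw [← htop (m + 1) (by omega) b (by omega), ← htop (m + 1) (by omega) (b - 2) (by omega),
        ← hb'.1, ← hb'.2]
      exact (h (m + 1) (by omega)).step (by omega) b (by omega)
  obtain ⟨g, hglow, hgstep⟩ := exists_step_extension (-B) (F.tail (m + 1))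
    (NoRep F.mem (m + 2)) (OneRep F.mem (m + 2))
  have hgstep' : ∀ b, B < b → (g b ↔ Step (Z (m + 2) b) (O (m + 2) b) (g (b - 2))) := by
    intro b hb
    have hb' := counts_top (m + 2) le_rfl b hb.le
    rw [hgstep b (by omega), hb'.1, hb'.2]
  have hpow : (2 ^ (m + 1) : ℤ) = 2 * (2 ^ m : ℕ) := by
    push_cast
    ring
  have hpow' : (2 ^ (m + 2) : ℤ) = 4 * (2 ^ m : ℕ) := by
    push_cast
    ring
  obtain ⟨P, hPper, hgP⟩ := exists_periodic_of_eventually (B := B + 1 + 2 ^ (m + 1))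
    (d := 2 ^ (m + 2)) (g := g) (by positivity) (by
      intro b hb
      have := eventually_periodic_of_step (d := 2 ^ m) (hpow ▸ hZ (m + 2) le_rfl)
        (hpow ▸ hO (m + 2) le_rfl) hgstep' (b := b - 2 ^ (m + 1)) (by omega)
      rwa [← hpow, ← hpow', sub_add_cancel] at this)
  refine ⟨(g, P), ?_⟩
  set G : Levels := Function.update F (m + 2) (g, P) with hG
  have hGlow : ∀ i < m + 2, G i = F i := fun i hi => Function.update_of_ne (by omega) _ _
  have hGmem : G.mem (m + 2) = g := by simp [Levels.mem, hG]
  have hGtail : G.tail (m + 2) = P := by simp [Levels.tail, hG]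
  have hGtail' : G.tail (m + 2 - 1) = F.tail (m + 1) := congrArg Prod.snd (hGlow (m + 1) (by omega))
  have hcongr : ∀ i < m + 2, G.mem i = F.mem i := fun i hi => congrArg Prod.fst (hGlow i hi)
  refine ⟨hGtail ▸ hPper, ⟨B + 1 + 2 ^ (m + 1), ?_⟩, ⟨-B, ?_⟩, by omega, by omega, ?_⟩
  · rw [hGmem, hGtail]
    exact hgP
  · rw [hGmem, hGtail']
    exact hglow
  · intro _ x _
    rw [hGmem, NoRep.congr hcongr, OneRep.congr hcongr]
    rcases le_or_gt x (-B) with hx | hx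
    · rw [hglow x hx, hglow (x - 2) (by omega), (counts_bot x hx).1, (counts_bot x hx).2]
      exact tail_step x
    · exact hgstep x hx

theorem not_rep_one {M : ℕ → ℤ → Prop} {b : ℤ} {i : ℕ} {x : ℤ} {j : ℕ} {y : ℤ} :
    ¬ Rep M 1 b i x j y := by
  rintro ⟨h1, h2, h3, -⟩
  omega

theorem Levels.exists_good (e : ℤ) : ∃ F : Levels, ∀ n, F.Good e n := by
  refine exists_seq_of_extension (Levels.Good e) (fun F G n h => Good.congr h) fun F n h => ?_
  match n with
  | 0 =>
    refine ⟨(fun x => x = 2, fun _ => False), ?_⟩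
    set G : Levels := Function.update F 0 (fun x => x = 2, fun _ => False) with hG
    have h1 : G.mem 0 = fun x => x = 2 := by simp [Levels.mem, hG]
    have h2 : G.tail 0 = fun _ => False := by simp [Levels.tail, hG]
    refine ⟨?_, ⟨3, ?_⟩, ⟨1, ?_⟩, fun _ => ⟨?_, ?_⟩, by omega, by omega⟩
    · rw [h2]
      exact fun _ => rfl
    · rw [h1, h2]
      intro x hx
      simp only [iff_false]
      omega
    · rw [Nat.zero_sub, h1, h2]
      intro x hx
      simp only [iff_false]
      omega
    · rw [h1]
      exact fun _ => Iff.rfl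
    · rw [h2]
      exact fun _ => id
  | 1 =>
    refine ⟨(fun x => e ≤ x ∧ 2 ∣ x - e, fun x => 2 ∣ x - e), ?_⟩
    set G : Levels := Function.update F 1 (fun x => e ≤ x ∧ 2 ∣ x - e, fun x => 2 ∣ x - e) with hG
    have h1 : G.mem 1 = fun x => e ≤ x ∧ 2 ∣ x - e := by simp [Levels.mem, hG]
    have h2 : G.tail 1 = fun x => 2 ∣ x - e := by simp [Levels.tail, hG]
    have h3 : ∀ x, ¬ G.tail 0 x := by
      have : G.tail 0 = Levels.tail F 0 := by simp [Levels.tail, hG]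
      rw [this]
      exact ((h 0 (by omega)).mem_zero rfl).2
    refine ⟨?_, ⟨e, ?_⟩, ⟨e - 1, ?_⟩, by omega, fun _ => ⟨?_, ?_⟩, ?_⟩
    · rw [h2]
      intro x
      apply propext
      simp only
      omega
    · rw [h1, h2]
      intro x hx
      simp only
      omega
    · rw [h1]
      intro x hx
      simp only [Nat.sub_self, h3, iff_false]
      omega
    · rw [h1]
      exact fun _ => Iff.rfl
    · rw [h2]
      exact fun _ => Iff.rfl
    · intro _ x hx
      have hno : NoRep G.mem 1 x := fun _ _ _ _ => not_rep_one
      have hone : ¬ OneRep G.mem 1 x := fun ⟨_, _, _, _, hr, _⟩ => not_rep_one hr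
      simp only [Step, hno, hone, h1, and_true, and_false, or_false]
      have := hx rfl
      omega
  | m + 2 => exact exists_next h

/-- The element `x` of level `n`, in coordinates in which `(1, e)` becomes `(1, 0)`. -/
def place (e : ℤ) (n : ℕ) (x : ℤ) : ℤ ×ₗ ℤ := toLex ((n : ℤ), x - e * n)

/-- The subset of `ℤ ×ₗ ℤ` with given levels. -/
def ulamSet (e : ℤ) (M : ℕ → ℤ → Prop) : Set (ℤ ×ₗ ℤ) := {p | ∃ n x, M n x ∧ p = place e n x}

theorem place_le_place {e : ℤ} {i j : ℕ} {x y : ℤ} :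
    place e i x ≤ place e j y ↔ i < j ∨ (i = j ∧ x ≤ y) := by
  rw [place, place, Prod.Lex.toLex_le_toLex]
  simp only [Nat.cast_lt, Nat.cast_inj]
  refine or_congr_right (and_congr_right ?_)
  rintro rfl
  simp

theorem place_inj {e : ℤ} {i j : ℕ} {x y : ℤ} : place e i x = place e j y ↔ i = j ∧ x = y := by
  simp only [place, toLex_inj, Prod.mk.injEq, Nat.cast_inj]
  refine and_congr_right ?_
  rintro rfl
  simp

theorem place_add_place (e : ℤ) (i j : ℕ) (x y : ℤ) :
    place e i x + place e j y = place e (i + j) (x + y) := by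
  simp only [place, ← toLex_add, Prod.mk_add_mk, Nat.cast_add]
  congr 2
  ring

theorem place_mem_ulamSet {e : ℤ} {M : ℕ → ℤ → Prop} {n : ℕ} {x : ℤ} :
    place e n x ∈ ulamSet e M ↔ M n x := by
  constructor
  · rintro ⟨n', x', h, heq⟩
    obtain ⟨rfl, rfl⟩ := place_inj.1 heq
    exact h
  · exact fun h => ⟨n, x, h, rfl⟩

theorem existsUnique_lt_add_iff {G : Type*} [AddCommGroup G] [LinearOrder G] {U : Set G} {w : G} :
    (∃! p : G × G, p.1 < p.2 ∧ p.1 ∈ U ∧ p.2 ∈ U ∧ w = p.1 + p.2) ↔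
      ∃ x ∈ U, ∃ y ∈ U, x ≠ y ∧ x + y = w ∧
        ∀ x' ∈ U, ∀ y' ∈ U, x' ≠ y' → x' + y' = w → x' = x ∨ x' = y := by
  constructor
  · rintro ⟨⟨x, y⟩, ⟨hxy, hx, hy, hw⟩, hu⟩
    refine ⟨x, hx, y, hy, hxy.ne, hw.symm, fun x' hx' y' hy' hne hw' => ?_⟩
    rcases lt_or_gt_of_ne hne with h | h
    · exact Or.inl (congrArg Prod.fst (hu (x', y') ⟨h, hx', hy', hw'.symm⟩))
    · exact Or.inr (congrArg Prod.snd (hu (y', x') ⟨h, hy', hx', by rw [← hw', add_comm]⟩))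
  · have key : ∀ x ∈ U, ∀ y ∈ U, x < y → x + y = w →
        (∀ x' ∈ U, ∀ y' ∈ U, x' ≠ y' → x' + y' = w → x' = x ∨ x' = y) →
        ∃! p : G × G, p.1 < p.2 ∧ p.1 ∈ U ∧ p.2 ∈ U ∧ w = p.1 + p.2 := by
      intro x hx y hy hxy hw hu
      refine ⟨(x, y), ⟨hxy, hx, hy, hw.symm⟩, ?_⟩
      rintro ⟨x', y'⟩ ⟨hlt, hx', hy', hw'⟩
      simp only at hlt hx' hy' hw'
      rcases hu x' hx' y' hy' hlt.ne hw'.symm with rfl | rfl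
      · rw [add_left_cancel (hw.trans hw')]
      · rw [add_comm] at hw
        obtain rfl := add_left_cancel (hw.trans hw')
        exact (lt_asymm hxy hlt).elim
    rintro ⟨x, hx, y, hy, hne, hw, hu⟩
    rcases lt_or_gt_of_ne hne with h | h
    · exact key x hx y hy h hw hu
    · exact key y hy x hx h (by rw [← hw, add_comm]) fun x' hx' y' hy' hne' hw' =>
        (hu x' hx' y' hy' hne' hw').symm

/-- For a set whose only element of level zero is `2`, the Ulam rule says that there is exactly one
representation. -/
theorem existsUnique_place_iff_step {e : ℤ} {M : ℕ → ℤ → Prop} (hM : ∀ x, M 0 x ↔ x = 2) {n : ℕ}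
    (hn : 1 ≤ n) (b : ℤ) :
    (∃! p : (ℤ ×ₗ ℤ) × (ℤ ×ₗ ℤ), p.1 < p.2 ∧ p.1 ∈ ulamSet e M ∧ p.2 ∈ ulamSet e M ∧
      place e n b = p.1 + p.2) ↔ Step (NoRep M n b) (OneRep M n b) (M n (b - 2)) := by
  rw [existsUnique_lt_add_iff]
  have cases_zero : ∀ i x j y, M i x → M j y → i + j = n → x + y = b → ¬ (i = j ∧ x = y) →
      Rep M n b i x j y ∨ (i = 0 ∧ x = 2 ∧ j = n ∧ y = b - 2) ∨
        (j = 0 ∧ y = 2 ∧ i = n ∧ x = b - 2) := by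
    intro i x j y hx hy hij hxy hne
    rcases Nat.eq_zero_or_pos i with rfl | hi
    · have := (hM x).1 hx
      omega
    rcases Nat.eq_zero_or_pos j with rfl | hj
    · have := (hM y).1 hy
      omega
    exact Or.inl ⟨hi, hj, hij, hxy, hx, hy, hne⟩
  have h0 : place e 0 2 ∈ ulamSet e M := place_mem_ulamSet.2 ((hM 2).2 rfl)
  have hne0 : ∀ x, place e 0 2 ≠ place e n x := fun x h => by
    have := (place_inj.1 h).1
    omega
  have hadd0 : place e 0 2 + place e n (b - 2) = place e n b := by
    rw [place_add_place]
    congr 1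
    · omega
    · ring
  have add_of_rep : ∀ {i x j y}, Rep M n b i x j y → place e i x + place e j y = place e n b := by
    rintro i x j y ⟨-, -, rfl, rfl, -⟩
    exact place_add_place e i j x y
  have ne_of_rep : ∀ {i x j y}, Rep M n b i x j y → place e i x ≠ place e j y :=
    fun hr h => hr.2.2.2.2.2.2 (place_inj.1 h)
  constructor
  · rintro ⟨-, ⟨i, x, hx, rfl⟩, -, ⟨j, y, hy, rfl⟩, hne, hw, hu⟩
    rw [place_add_place, place_inj] at hw
    rw [Ne, place_inj] at hne
    have huR : ∀ i' x' j' y', Rep M n b i' x' j' y' → (i' = i ∧ x' = x) ∨ (i' = j ∧ x' = y) := by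
      intro i' x' j' y' hr
      have := hu _ (place_mem_ulamSet.2 hr.2.2.2.2.1) _ (place_mem_ulamSet.2 hr.2.2.2.2.2.1)
        (ne_of_rep hr) (add_of_rep hr)
      rwa [place_inj, place_inj] at this
    rcases cases_zero i x j y hx hy hw.1 hw.2 hne with hr | h | h
    · refine Or.inr ⟨fun hq => ?_, i, x, j, y, hr, huR⟩
      have := hu _ h0 _ (place_mem_ulamSet.2 hq) (hne0 _) hadd0
      rw [place_inj, place_inj] at this
      obtain ⟨h1, h2, -⟩ := hr
      omega
    · refine Or.inl ⟨by rw [← h.2.2.1, ← h.2.2.2]; exact hy, fun i' x' j' y' hr => ?_⟩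
      have h1 := huR _ _ _ _ hr
      have h2 := huR _ _ _ _ hr.symm
      obtain ⟨h3, h4, h5, -⟩ := hr
      omega
    · refine Or.inl ⟨by rw [← h.2.2.1, ← h.2.2.2]; exact hx, fun i' x' j' y' hr => ?_⟩
      have h1 := huR _ _ _ _ hr
      have h2 := huR _ _ _ _ hr.symm
      obtain ⟨h3, h4, h5, -⟩ := hr
      omega
  · rintro (⟨hq, hno⟩ | ⟨hq, i, x, j, y, hr, hu⟩)
    · refine ⟨_, h0, _, place_mem_ulamSet.2 hq, hne0 _, hadd0, ?_⟩
      rintro - ⟨i, x, hx, rfl⟩ - ⟨j, y, hy, rfl⟩ hne hw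
      rw [place_add_place, place_inj] at hw
      rw [Ne, place_inj] at hne
      rw [place_inj, place_inj]
      rcases cases_zero i x j y hx hy hw.1 hw.2 hne with hr | h | h
      · exact (hno _ _ _ _ hr).elim
      · omega
      · omega
    · refine ⟨_, place_mem_ulamSet.2 hr.2.2.2.2.1, _, place_mem_ulamSet.2 hr.2.2.2.2.2.1,
        ne_of_rep hr, add_of_rep hr, ?_⟩
      rintro - ⟨i', x', hx', rfl⟩ - ⟨j', y', hy', rfl⟩ hne hw
      rw [place_add_place, place_inj] at hw
      rw [Ne, place_inj] at hne
      rw [place_inj, place_inj]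
      rcases cases_zero i' x' j' y' hx' hy' hw.1 hw.2 hne with h | h | h
      · exact hu _ _ _ _ h
      · exact (hq (by rw [← h.2.2.1, ← h.2.2.2]; exact hy')).elim
      · exact (hq (by rw [← h.2.2.1, ← h.2.2.2]; exact hx')).elim

section Final

variable {e : ℤ} {F : Levels}

theorem Levels.exists_ge_mem (h : ∀ n, F.Good e n) {n : ℕ} {x : ℤ} (hx : F.tail n x) (B : ℤ) :
    ∃ y ≥ B, F.mem n y := by
  obtain ⟨N, hN⟩ := (h n).top
  have hd : (0 : ℤ) < 2 ^ n := by positivity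
  have hle : (max B N - x).toNat ≤ (max B N - x).toNat * (2 ^ n : ℤ) :=
    le_mul_of_one_le_right (by omega) hd
  refine ⟨x + (max B N - x).toNat * 2 ^ n, by omega, (hN _ (by omega)).2 ?_⟩
  rwa [(h n).periodic.nat_mul _ x]

theorem Levels.exists_le_mem_succ (h : ∀ n, F.Good e n) {n : ℕ} {x : ℤ} (hx : F.tail n x) (B : ℤ) :
    ∃ y ≤ B, F.mem (n + 1) y := by
  obtain ⟨N, hN⟩ := (h (n + 1)).bot
  have hd : (0 : ℤ) < 2 ^ n := by positivity
  have hle : (x - min B N).toNat ≤ (x - min B N).toNat * (2 ^ n : ℤ) :=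
    le_mul_of_one_le_right (by omega) hd
  refine ⟨x - (x - min B N).toNat * 2 ^ n, by omega, (hN _ (by omega)).2 ?_⟩
  rwa [Nat.add_sub_cancel, (h n).periodic.sub_nat_mul_eq]

theorem Levels.exists_min (h : ∀ n, F.Good e n) {p q : ℤ ×ₗ ℤ}
    (hne : (ulamSet e F.mem ∩ Set.Icc p q).Nonempty) :
    ∃ m ∈ ulamSet e F.mem ∩ Set.Icc p q, ∀ x ∈ ulamSet e F.mem ∩ Set.Icc p q, m ≤ x := by
  classical
  obtain ⟨p₁, p₂⟩ := p
  obtain ⟨q₁, q₂⟩ := q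
  have hex : ∃ n : ℕ, ∃ x, F.mem n x ∧ place e n x ∈ Set.Icc (toLex (p₁, p₂)) (toLex (q₁, q₂)) := by
    obtain ⟨-, ⟨n, x, hx, rfl⟩, hI⟩ := hne
    exact ⟨n, x, hx, hI⟩
  have hspec := Nat.find_spec hex
  have hmin := fun k => Nat.find_min' hex (m := k)
  set a := Nat.find hex
  have hbdd : ∃ B : ℤ, ∀ x, F.mem a x ∧ place e a x ∈ Set.Icc (toLex (p₁, p₂)) (toLex (q₁, q₂)) →
      B ≤ x := by
    by_contra! hunb
    obtain ⟨N, hN⟩ := (h a).bot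
    obtain ⟨x, ⟨hx, hxp, hxq⟩, hxN⟩ := hunb (min N (p₂ + e * a))
    have ht : F.tail (a - 1) x := (hN x (by omega)).1 hx
    obtain ⟨c, hc⟩ : ∃ c, a = c + 1 := by
      refine Nat.exists_eq_succ_of_ne_zero fun h0 => ((h 0).mem_zero rfl).2 x ?_
      rwa [h0] at ht
    rw [hc, Nat.add_sub_cancel] at ht
    obtain ⟨y, hy, hcy⟩ := exists_ge_mem h ht (p₂ + e * c)
    rw [place, Prod.Lex.toLex_le_toLex] at hxp hxq
    have := hmin c ⟨y, hcy, by
      rw [place, Prod.Lex.toLex_le_toLex]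
      simp only at hxp ⊢
      omega, by
      rw [place, Prod.Lex.toLex_le_toLex]
      simp only at hxq ⊢
      omega⟩
    omega
  obtain ⟨x, ⟨hx, hxI⟩, hleast⟩ := Int.exists_least_of_bdd hbdd hspec
  refine ⟨place e a x, ⟨place_mem_ulamSet.2 hx, hxI⟩, ?_⟩
  rintro - ⟨⟨n, y, hy, rfl⟩, hyI⟩
  rw [place_le_place]
  rcases (hmin n ⟨y, hy, hyI⟩).lt_or_eq with hlt | heq
  · exact Or.inl hlt
  · exact Or.inr ⟨heq, hleast y ⟨heq ▸ hy, heq ▸ hyI⟩⟩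

theorem Levels.exists_max (h : ∀ n, F.Good e n) {p q : ℤ ×ₗ ℤ}
    (hne : (ulamSet e F.mem ∩ Set.Icc p q).Nonempty) :
    ∃ m ∈ ulamSet e F.mem ∩ Set.Icc p q, ∀ x ∈ ulamSet e F.mem ∩ Set.Icc p q, x ≤ m := by
  obtain ⟨p₁, p₂⟩ := p
  obtain ⟨q₁, q₂⟩ := q
  have hex : ∃ z : ℤ, ∃ n : ℕ, z = n ∧
      ∃ x, F.mem n x ∧ place e n x ∈ Set.Icc (toLex (p₁, p₂)) (toLex (q₁, q₂)) := by
    obtain ⟨-, ⟨n, x, hx, rfl⟩, hI⟩ := hne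
    exact ⟨n, n, rfl, x, hx, hI⟩
  obtain ⟨-, ⟨a, rfl, hspec⟩, hmax⟩ := Int.exists_greatest_of_bdd (by
    refine ⟨q₁, ?_⟩
    rintro - ⟨n, rfl, x, -, -, hxq⟩
    rw [place, Prod.Lex.toLex_le_toLex] at hxq
    simp only at hxq
    omega) hex
  have hbdd : ∃ B : ℤ, ∀ x, F.mem a x ∧ place e a x ∈ Set.Icc (toLex (p₁, p₂)) (toLex (q₁, q₂)) →
      x ≤ B := by
    by_contra! hunb
    obtain ⟨N, hN⟩ := (h a).top
    obtain ⟨x, ⟨hx, hxp, hxq⟩, hxN⟩ := hunb (max N (q₂ + e * a))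
    have ht : F.tail a x := (hN x (by omega)).1 hx
    obtain ⟨y, hy, hcy⟩ := exists_le_mem_succ h ht (q₂ + e * (a + 1 : ℕ))
    rw [place, Prod.Lex.toLex_le_toLex] at hxp hxq
    have := hmax _ ⟨a + 1, rfl, y, hcy, by
      rw [place, Prod.Lex.toLex_le_toLex]
      simp only at hxp ⊢
      omega, by
      rw [place, Prod.Lex.toLex_le_toLex]
      simp only at hxq ⊢
      omega⟩
    omega
  obtain ⟨x, ⟨hx, hxI⟩, hgreatest⟩ := Int.exists_greatest_of_bdd hbdd hspec
  refine ⟨place e a x, ⟨place_mem_ulamSet.2 hx, hxI⟩, ?_⟩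
  rintro - ⟨⟨n, y, hy, rfl⟩, hyI⟩
  rw [place_le_place]
  rcases (Int.ofNat_le.1 (hmax n ⟨n, rfl, y, hy, hyI⟩)).lt_or_eq with hlt | heq
  · exact Or.inl hlt
  · exact Or.inr ⟨heq, hgreatest y ⟨heq ▸ hy, heq ▸ hyI⟩⟩

/-- A set containing `v` in which, beyond `v`, the elements are exactly those with one
representation satisfies the recursive condition on Ulam sequences. -/
theorem mem_iff_isLeast_ulamNext {U : Set (ℤ ×ₗ ℤ)} {v : ℤ ×ₗ ℤ} (hv : v ∈ U)
    (hU : ∀ w, v < w → (w ∈ U ↔ ∃! p : (ℤ ×ₗ ℤ) × (ℤ ×ₗ ℤ),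
      p.1 < p.2 ∧ p.1 ∈ U ∧ p.2 ∈ U ∧ w = p.1 + p.2)) {w : ℤ ×ₗ ℤ} (hw : v < w) :
    w ∈ U ↔ w ∈ ulamNext U w ∧ ∀ q ∈ ulamNext U w, w ≤ q := by
  constructor
  · intro h
    refine ⟨⟨fun x _ hx => hx, (hU w hw).1 h⟩, fun q hq => ?_⟩
    by_contra! hlt
    exact lt_irrefl q (hq.1 q ((hU q (hq.1 v hv hw)).2 hq.2) hlt)
  · exact fun h => (hU w hw).2 h.1.2

theorem Levels.isUlamSeq (h : ∀ n, F.Good e n) :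
    IsUlamSeq (toLex (0, 2)) (toLex (1, 0)) (ulamSet e F.mem) := by
  have h0 := ((h 0).mem_zero rfl).1
  have h1 := ((h 1).mem_one rfl).1
  have hu : toLex ((0 : ℤ), (2 : ℤ)) = place e 0 2 := by simp [place]
  have hv : toLex ((1 : ℤ), (0 : ℤ)) = place e 1 e := by simp [place]
  refine ⟨?_, fun p q _ hne => ⟨exists_min h hne, exists_max h hne⟩, fun w hw => ?_⟩
  · rw [hu, hv]
    ext w
    constructor
    · rintro ⟨⟨n, x, hx, rfl⟩, hle⟩
      rw [Set.mem_Iic, place_le_place] at hle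
      obtain rfl | rfl : n = 0 ∨ n = 1 := by omega
      · exact Or.inl (by rw [(h0 x).1 hx])
      · refine Or.inr (Set.mem_singleton_iff.2 (place_inj.2 ⟨rfl, ?_⟩))
        have := (h1 x).1 hx
        omega
    · rintro (rfl | rfl)
      · exact ⟨place_mem_ulamSet.2 ((h0 2).2 rfl), place_le_place.2 (Or.inl zero_lt_one)⟩
      · exact ⟨place_mem_ulamSet.2 ((h1 e).2 ⟨le_rfl, by simp⟩), Set.mem_Iic.2 le_rfl⟩
  · refine mem_iff_isLeast_ulamNext ?_ (fun w hw => ?_) hw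
    · rw [hv]
      exact place_mem_ulamSet.2 ((h1 e).2 ⟨le_rfl, by simp⟩)
    · obtain ⟨a, b⟩ := w
      change toLex _ < toLex (a, b) at hw
      change toLex (a, b) ∈ _ ↔ _
      rw [Prod.Lex.toLex_lt_toLex] at hw
      simp only at hw
      obtain ⟨n, rfl⟩ := Int.eq_ofNat_of_zero_le (show 0 ≤ a by omega)
      have hpl : toLex ((n : ℤ), b) = place e n (b + e * n) := by simp [place]
      change _ ↔ ∃! p : (ℤ ×ₗ ℤ) × (ℤ ×ₗ ℤ), p.1 < p.2 ∧ p.1 ∈ ulamSet e F.mem ∧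
        p.2 ∈ ulamSet e F.mem ∧ toLex ((n : ℤ), b) = p.1 + p.2
      rw [hpl, existsUnique_place_iff_step h0 (by omega), place_mem_ulamSet]
      refine (h n).step (by omega) _ ?_
      rintro rfl
      have hb : 0 < b := by simpa using hw
      rw [Nat.cast_one, mul_one]
      omega

theorem Levels.mem_two_iff (h : ∀ n, F.Good e n) {x : ℤ} (hx : x ≤ 2 * e + 1) :
    F.mem 2 x ↔ 2 ∣ x - e := by
  have h1 := (h 1).mem_one rfl
  have hno : ∀ x ≤ 2 * e + 1, NoRep F.mem 2 x := by
    rintro x hx i y j z ⟨hi, hj, hij, hyz, hy, hz, hne⟩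
    obtain rfl : i = 1 := by omega
    obtain rfl : j = 1 := by omega
    have := (h1.1 y).1 hy
    have := (h1.1 z).1 hz
    omega
  have hstep : ∀ x ≤ 2 * e + 1, (F.mem 2 x ↔ F.mem 2 (x - 2)) := by
    intro x hx
    have hone : ¬ OneRep F.mem 2 x := fun ⟨_, _, _, _, hr, _⟩ => hno x hx _ _ _ _ hr
    rw [(h 2).step one_le_two x (by omega)]
    simp only [Step, hno x hx, hone, and_true, and_false, or_false]
  have hiter : ∀ k : ℕ, F.mem 2 x ↔ F.mem 2 (x - 2 * k) := by
    intro k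
    induction k with
    | zero => simp
    | succ k ih =>
      rw [ih, hstep _ (by omega)]
      congr! 1
      push_cast
      ring
  obtain ⟨N, hN⟩ := (h 2).bot
  rw [hiter (x - N).toNat, hN _ (by omega), h1.2]
  omega

theorem Levels.initial_segment (h : ∀ n, F.Good e n) :
    ulamSet e F.mem ∩ Set.Icc (toLex (0, 2)) (toLex (2, 1)) =
      {toLex ((0 : ℤ), (2 : ℤ))} ∪ {x | ∃ k : ℕ, x = toLex (1, 2 * (k : ℤ))} ∪
        {x | ∃ b : ℤ, b ≤ 1 ∧ 2 ∣ b - e ∧ x = toLex (2, b)} := by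
  have h0 := ((h 0).mem_zero rfl).1
  have h1 := ((h 1).mem_one rfl).1
  ext w
  constructor
  · rintro ⟨⟨n, x, hx, rfl⟩, -, hle⟩
    rw [place, Prod.Lex.toLex_le_toLex] at hle
    simp only at hle
    obtain rfl | rfl | rfl : n = 0 ∨ n = 1 ∨ n = 2 := by omega
    · refine Or.inl (Or.inl ?_)
      rw [(h0 x).1 hx]
      simp [place]
    · refine Or.inl (Or.inr ⟨((x - e) / 2).toNat, ?_⟩)
      have := (h1 x).1 hx
      simp only [place, Nat.cast_one, mul_one]
      congr 2
      omega
    · have hle' : x - e * 2 ≤ 1 := by simpa using hle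
      refine Or.inr ⟨x - e * 2, hle', ?_, by simp [place]⟩
      have := (mem_two_iff h (x := x) (by omega)).1 hx
      omega
  · rintro ((rfl | ⟨k, rfl⟩) | ⟨b, hb, hdvd, rfl⟩)
    · refine ⟨⟨0, 2, (h0 2).2 rfl, by simp [place]⟩, ?_⟩
      simp [Prod.Lex.toLex_le_toLex]
    · refine ⟨⟨1, 2 * k + e, (h1 _).2 (by omega), by simp [place]⟩, ?_⟩
      simp [Prod.Lex.toLex_le_toLex]
    · refine ⟨⟨2, b + e * 2, (mem_two_iff h (by omega)).2 (by omega), by simp [place]⟩, ?_⟩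
      simp [Prod.Lex.toLex_le_toLex, hb]

end Final

end UlamLevels

/-- There exist two distinct Ulam sequences `U, U′` starting with `2 = (0,2)`, `X = (1,0)` in
`ℤ ×ₗ ℤ`, with `U ∩ [2, 2X+1] = {2} ∪ {X + 2k : k ∈ ℕ} ∪ {2X − 2k : k ∈ ℕ}` and
`U′ ∩ [2, 2X+1] = {2} ∪ {X + 2k : k ∈ ℕ} ∪ {2X − 2k + 1 : k ∈ ℕ}`. -/
theorem statement16 :
    ∃ U U' : Set (ℤ ×ₗ ℤ),
      IsUlamSeq (toLex (0, 2)) (toLex (1, 0)) U ∧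
      IsUlamSeq (toLex (0, 2)) (toLex (1, 0)) U' ∧
      U ≠ U' ∧
      U ∩ Set.Icc (toLex (0, 2)) (toLex (2, 1)) =
        {toLex ((0 : ℤ), (2 : ℤ))} ∪ {x | ∃ k : ℕ, x = toLex (1, 2 * (k : ℤ))} ∪
          {x | ∃ k : ℕ, x = toLex (2, -(2 * (k : ℤ)))} ∧
      U' ∩ Set.Icc (toLex (0, 2)) (toLex (2, 1)) =
        {toLex ((0 : ℤ), (2 : ℤ))} ∪ {x | ∃ k : ℕ, x = toLex (1, 2 * (k : ℤ))} ∪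
          {x | ∃ k : ℕ, x = toLex (2, -(2 * (k : ℤ)) + 1)} := by
  obtain ⟨F, hF⟩ := UlamLevels.Levels.exists_good 0
  obtain ⟨F', hF'⟩ := UlamLevels.Levels.exists_good 1
  have hseg : UlamLevels.ulamSet 0 F.mem ∩ Set.Icc (toLex (0, 2)) (toLex (2, 1)) =
      {toLex ((0 : ℤ), (2 : ℤ))} ∪ {x | ∃ k : ℕ, x = toLex (1, 2 * (k : ℤ))} ∪
        {x | ∃ k : ℕ, x = toLex (2, -(2 * (k : ℤ)))} := by
    rw [UlamLevels.Levels.initial_segment hF]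
    congr 1
    ext x
    constructor
    · rintro ⟨b, hb, hdvd, rfl⟩
      exact ⟨(-b / 2).toNat, by congr 2; omega⟩
    · rintro ⟨k, rfl⟩
      exact ⟨_, by omega, by omega, rfl⟩
  have hseg' : UlamLevels.ulamSet 1 F'.mem ∩ Set.Icc (toLex (0, 2)) (toLex (2, 1)) =
      {toLex ((0 : ℤ), (2 : ℤ))} ∪ {x | ∃ k : ℕ, x = toLex (1, 2 * (k : ℤ))} ∪
        {x | ∃ k : ℕ, x = toLex (2, -(2 * (k : ℤ)) + 1)} := by
    rw [UlamLevels.Levels.initial_segment hF']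
    congr 1
    ext x
    constructor
    · rintro ⟨b, hb, hdvd, rfl⟩
      exact ⟨((1 - b) / 2).toNat, by congr 2; omega⟩
    · rintro ⟨k, rfl⟩
      exact ⟨_, by omega, by omega, rfl⟩
  refine ⟨_, _, UlamLevels.Levels.isUlamSeq hF, UlamLevels.Levels.isUlamSeq hF',
    fun heq => ?_, hseg, hseg'⟩
  rw [heq, hseg'] at hseg
  have hmem : toLex ((2 : ℤ), (1 : ℤ)) ∈ ({toLex ((0 : ℤ), (2 : ℤ))} ∪
      {x | ∃ k : ℕ, x = toLex (1, 2 * (k : ℤ))} ∪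
        {x | ∃ k : ℕ, x = toLex (2, -(2 * (k : ℤ)) + 1)} : Set (ℤ ×ₗ ℤ)) :=
    Or.inr ⟨0, rfl⟩
  rw [hseg] at hmem
  rcases hmem with (h | ⟨k, h⟩) | ⟨k, h⟩
  · simp at h
  · simp at h
  · simp only [toLex_inj, Prod.mk.injEq] at h
    omega
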